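/- Let T > 0. Suppose there exists C > 0 such that the weak observability inequality ‖u₀‖²_{L²(𝕋)} ≤ C ∫₀ᵀ ‖g · S_λ(t)u₀‖²_{L²(𝕋)} dt + C ‖u₀‖²_{H^{−1}(𝕋)} holds for all λ ≥ 0 and all u₀ ∈ L²₀(𝕋). Then there exists C' > 0 such that the full observability inequality ‖u₀‖²_{L²(𝕋)} ≤ C' ∫₀ᵀ ‖𝒢(S_λ(t)u₀)‖²_{L²(𝕋)} dt holds for all λ ≥ 0 and all u₀ ∈ L²₀(𝕋). -/

import Mathlib

open MeasureTheory Real Filter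

noncomputable section

instance : Fact (0 < 2 * Real.pi) := ⟨by positivity⟩

/-- The torus `𝕋 = ℝ/2πℤ`. -/
abbrev Torus := AddCircle (2 * Real.pi)

/-- `L²(𝕋)`. -/
abbrev L2T := Lp ℂ 2 (volume : Measure Torus)

/-- Fourier coefficient `û(k) = (1/2π) ∫_𝕋 u(x) e^{-ikx} dx`. -/
def fc (u : Torus → ℂ) (k : ℤ) : ℂ :=
  (1 / (2 * Real.pi)) * ∫ x : Torus, fourier (-k) x * u x

/-- Membership in `L²₀(𝕋)`: the mean `û(0)` vanishes. -/
def MeanZero (u : L2T) : Prop := fc (u : Torus → ℂ) 0 = 0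

/-- The squared `H⁻¹(𝕋)` norm `‖u‖²_{H⁻¹} = Σ_k (1+k²)⁻¹ |û(k)|²`. -/
def Hneg1Sq (u : L2T) : ℝ := ∑' k : ℤ, (1 + (k : ℝ) ^ 2)⁻¹ * ‖fc (u : Torus → ℂ) k‖ ^ 2

/-- Squared `L²` norm of the pointwise product `g · v`. -/
def gMulNormSq (g : Torus → ℝ) (v : L2T) : ℝ :=
  ∫ x : Torus, ‖(g x : ℂ) * (v : Torus → ℂ) x‖ ^ 2

/-- Spectral characterization of the unitary group `S_λ(t)` on `L²₀(𝕋)` solving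
`∂ₜu + ∂ₓ³u - λ²∂ₓ⁻¹u = 0`: `(S_λ(t)u)^(k) = e^{it(k³ - λ²/k)} û(k)` for `k ≠ 0`. -/
def IsLamGroup (lam : ℝ) (S : ℝ → L2T →L[ℂ] L2T) : Prop :=
  ∀ t : ℝ, ∀ u : L2T, MeanZero u →
    MeanZero (S t u) ∧
      ∀ k : ℤ, k ≠ 0 →
        fc (S t u : Torus → ℂ) k =
          Complex.exp (Complex.I * (t : ℂ) * ((k : ℂ) ^ 3 - (lam : ℂ) ^ 2 / (k : ℂ))) *
            fc (u : Torus → ℂ) k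

/-- Spectral characterization of the semiclassical unitary group `Sʰ(t)` on `L²₀(𝕋)` solving
`h∂ₜu + (h∂ₓ)³u - (h∂ₓ)⁻¹u = 0`: `(Sʰ(t)u)^(k) = e^{it(h²k³ - 1/(h²k))} û(k)` for `k ≠ 0`. -/
def IsSemiGroup (h : ℝ) (S : ℝ → L2T →L[ℂ] L2T) : Prop :=
  ∀ t : ℝ, ∀ u : L2T, MeanZero u →
    MeanZero (S t u) ∧
      ∀ k : ℤ, k ≠ 0 →
        fc (S t u : Torus → ℂ) k =
          Complex.exp (Complex.I * (t : ℂ) *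
              ((h : ℂ) ^ 2 * (k : ℂ) ^ 3 - 1 / ((h : ℂ) ^ 2 * (k : ℂ)))) *
            fc (u : Torus → ℂ) k

/-- `(𝒢 v)(x) = g(x) (v(x) - ∫_𝕋 g(x') v(x') dx')` (a.e.). -/
def IsG (g : Torus → ℝ) (G : L2T →L[ℂ] L2T) : Prop :=
  ∀ v : L2T, ∀ᵐ x ∂(volume : Measure Torus),
    (G v : Torus → ℂ) x =
      (g x : ℂ) * ((v : Torus → ℂ) x - ∫ x' : Torus, (g x' : ℂ) * (v : Torus → ℂ) x')

/-- The Fourier multiplier `m(hDₓ)`: `(m(hDₓ)u)^(k) = m(hk) û(k)`. -/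
def IsMult (m : ℝ → ℝ) (h : ℝ) (M : L2T →L[ℂ] L2T) : Prop :=
  ∀ u : L2T, ∀ k : ℤ, fc (M u : Torus → ℂ) k = (m (h * k) : ℂ) * fc (u : Torus → ℂ) k

section PhaseFlow

variable {H : Type*} [NormedAddCommGroup H] [InnerProductSpace ℂ H]

/-- `S` acts on vectors with vanishing zeroth coefficient as the diagonal unitary group with
phases `φ` in the Hilbert basis `b`. -/
def IsPhaseFlow (b : HilbertBasis ℤ ℂ H) (φ : ℤ → ℝ) (S : ℝ → H →L[ℂ] H) : Prop :=
  ∀ t : ℝ, ∀ u : H, b.repr u 0 = 0 →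
    ∀ k : ℤ, b.repr (S t u) k = Complex.exp (Complex.I * t * φ k) * b.repr u k

/-- The energy of the trajectory `S t u` observed through `G` up to time `T`. -/
def obsEnergy (G : H →L[ℂ] H) (S : ℝ → H →L[ℂ] H) (T : ℝ) (u : H) : ℝ :=
  ∫ t in (0 : ℝ)..T, ‖G (S t u)‖ ^ 2

lemma HilbertBasis.hasSum_norm_sq_repr (b : HilbertBasis ℤ ℂ H) (u : H) :
    HasSum (fun k => ‖b.repr u k‖ ^ 2) (‖u‖ ^ 2) := by
  have h : HasSum (fun k => ‖b.repr u k‖ ^ 2) (‖b.repr u‖ ^ 2) := by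
    apply_mod_cast lp.hasSum_norm ?_ (b.repr u)
    simp
  simpa using h

lemma HilbertBasis.sum_norm_sq_repr_le (b : HilbertBasis ℤ ℂ H) (u : H) (K : Finset ℤ) :
    ∑ k ∈ K, ‖b.repr u k‖ ^ 2 ≤ ‖u‖ ^ 2 :=
  sum_le_hasSum K (fun _ _ => by positivity) (b.hasSum_norm_sq_repr u)

lemma HilbertBasis.norm_repr_le (b : HilbertBasis ℤ ℂ H) (u : H) (k : ℤ) :
    ‖b.repr u k‖ ≤ ‖u‖ := by
  have := b.sum_norm_sq_repr_le u {k}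
  rw [Finset.sum_singleton] at this
  exact le_of_sq_le_sq this (norm_nonneg _)

lemma HilbertBasis.norm_sq_le_of_sum_le (b : HilbertBasis ℤ ℂ H) {u : H} {B : ℝ}
    (h : ∀ K : Finset ℤ, ∑ k ∈ K, ‖b.repr u k‖ ^ 2 ≤ B) : ‖u‖ ^ 2 ≤ B :=
  hasSum_le_of_sum_le (b.hasSum_norm_sq_repr u) h

lemma HilbertBasis.ext_repr (b : HilbertBasis ℤ ℂ H) {u v : H}
    (h : ∀ k, b.repr u k = b.repr v k) : u = v :=
  b.repr.injective (lp.ext (funext h))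

lemma norm_exp_I_mul_mul (t x : ℝ) : ‖Complex.exp (Complex.I * t * x)‖ = 1 := by
  rw [show Complex.I * t * x = ((t * x : ℝ) : ℂ) * Complex.I by push_cast; ring]
  exact Complex.norm_exp_ofReal_mul_I _

namespace IsPhaseFlow

variable {b : HilbertBasis ℤ ℂ H} {φ : ℤ → ℝ} {S : ℝ → H →L[ℂ] H}

lemma repr_zero (hS : IsPhaseFlow b φ S) (t : ℝ) {u : H} (hu : b.repr u 0 = 0) :
    b.repr (S t u) 0 = 0 := by
  rw [hS t u hu, hu, mul_zero]

lemma norm_repr (hS : IsPhaseFlow b φ S) (t : ℝ) {u : H} (hu : b.repr u 0 = 0) (k : ℤ) :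
    ‖b.repr (S t u) k‖ = ‖b.repr u k‖ := by
  rw [hS t u hu, norm_mul, norm_exp_I_mul_mul, one_mul]

lemma norm_apply (hS : IsPhaseFlow b φ S) (t : ℝ) {u : H} (hu : b.repr u 0 = 0) :
    ‖S t u‖ = ‖u‖ := by
  have h1 := b.hasSum_norm_sq_repr (S t u)
  simp only [hS.norm_repr t hu] at h1
  exact (pow_left_inj₀ (norm_nonneg _) (norm_nonneg _) two_ne_zero).1
    (h1.unique (b.hasSum_norm_sq_repr u))

lemma apply_apply (hS : IsPhaseFlow b φ S) (t s : ℝ) {u : H} (hu : b.repr u 0 = 0) :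
    S t (S s u) = S (t + s) u := by
  refine b.ext_repr fun k => ?_
  rw [hS t _ (hS.repr_zero s hu), hS s u hu, hS (t + s) u hu, ← mul_assoc, ← Complex.exp_add]
  congr 2
  push_cast
  ring

lemma continuous_apply (hS : IsPhaseFlow b φ S) {u : H} (hu : b.repr u 0 = 0) :
    Continuous fun t => S t u := by
  rw [continuous_iff_continuousAt]
  intro s
  have key : ∀ t, ‖S t u - S s u‖ ^ 2 =
      ∑' k, ‖(Complex.exp (Complex.I * t * φ k) - Complex.exp (Complex.I * s * φ k)) *
        b.repr u k‖ ^ 2 := by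
    intro t
    rw [← (b.hasSum_norm_sq_repr (S t u - S s u)).tsum_eq]
    refine tsum_congr fun k => ?_
    rw [map_sub, lp.coeFn_sub, Pi.sub_apply, hS t u hu, hS s u hu, sub_mul]
  have hcont : Continuous fun t : ℝ => ‖S t u - S s u‖ ^ 2 := by
    simp only [key]
    refine continuous_tsum (u := fun k => 4 * ‖b.repr u k‖ ^ 2) (fun k => by fun_prop)
      ((b.hasSum_norm_sq_repr u).summable.mul_left 4) fun k t => ?_
    have h2 : ‖Complex.exp (Complex.I * t * φ k) - Complex.exp (Complex.I * s * φ k)‖ ≤ 2 := by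
      refine (norm_sub_le _ _).trans ?_
      rw [norm_exp_I_mul_mul, norm_exp_I_mul_mul]
      norm_num
    rw [Real.norm_of_nonneg (by positivity), norm_mul, mul_pow]
    gcongr
    nlinarith [norm_nonneg (Complex.exp (Complex.I * t * φ k) - Complex.exp (Complex.I * s * φ k))]
  have h0 := (hcont.sqrt).tendsto s
  simp only [sub_self, norm_zero, Real.sqrt_sq (norm_nonneg _)] at h0
  rw [ContinuousAt, tendsto_iff_norm_sub_tendsto_zero]
  simpa using h0

lemma continuous_norm_sq (hS : IsPhaseFlow b φ S) (G : H →L[ℂ] H) {u : H}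
    (hu : b.repr u 0 = 0) : Continuous fun t => ‖G (S t u)‖ ^ 2 :=
  (G.continuous.comp (hS.continuous_apply hu)).norm.pow 2

end IsPhaseFlow

lemma obsEnergy_nonneg (G : H →L[ℂ] H) (S : ℝ → H →L[ℂ] H) {T : ℝ} (hT : 0 ≤ T) (u : H) :
    0 ≤ obsEnergy G S T u :=
  intervalIntegral.integral_nonneg hT fun _ _ => by positivity

section Energy

variable {b : HilbertBasis ℤ ℂ H} {φ : ℤ → ℝ} {S : ℝ → H →L[ℂ] H}

lemma IsPhaseFlow.obsEnergy_mono (hS : IsPhaseFlow b φ S) (G : H →L[ℂ] H) {T₁ T₂ : ℝ}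
    (h₁ : 0 ≤ T₁) (h₂ : T₁ ≤ T₂) {u : H} (hu : b.repr u 0 = 0) :
    obsEnergy G S T₁ u ≤ obsEnergy G S T₂ u :=
  intervalIntegral.integral_mono_interval le_rfl h₁ h₂
    (Eventually.of_forall fun _ => by positivity)
    ((hS.continuous_norm_sq G hu).intervalIntegrable _ _)

lemma IsPhaseFlow.norm_apply_apply_sq_le (hS : IsPhaseFlow b φ S) (G : H →L[ℂ] H) (t : ℝ) {u : H}
    (hu : b.repr u 0 = 0) : ‖G (S t u)‖ ^ 2 ≤ ‖G‖ ^ 2 * ‖u‖ ^ 2 := by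
  rw [← mul_pow, ← hS.norm_apply t hu]
  gcongr
  exact G.le_opNorm _

lemma IsPhaseFlow.obsEnergy_le_add (hS : IsPhaseFlow b φ S) (G : H →L[ℂ] H) {T₁ T₂ : ℝ}
    (h₂ : T₁ ≤ T₂) {u : H} (hu : b.repr u 0 = 0) :
    obsEnergy G S T₂ u ≤ obsEnergy G S T₁ u + (T₂ - T₁) * (‖G‖ ^ 2 * ‖u‖ ^ 2) := by
  have hint := fun p q => (hS.continuous_norm_sq G hu).intervalIntegrable (μ := volume) p q
  have h := intervalIntegral.integral_mono_on (μ := volume) h₂ (hint T₁ T₂)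
    intervalIntegrable_const fun t _ => hS.norm_apply_apply_sq_le G t hu
  rw [intervalIntegral.integral_const, smul_eq_mul] at h
  have := intervalIntegral.integral_add_adjacent_intervals (hint 0 T₁) (hint T₁ T₂)
  rw [obsEnergy, obsEnergy, ← this]
  linarith

lemma IsPhaseFlow.obsEnergy_le (hS : IsPhaseFlow b φ S) (G : H →L[ℂ] H) {T : ℝ}
    (hT : 0 ≤ T) {u : H} (hu : b.repr u 0 = 0) :
    obsEnergy G S T u ≤ T * (‖G‖ ^ 2 * ‖u‖ ^ 2) := by
  have h := hS.obsEnergy_le_add G hT hu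
  rwa [obsEnergy, obsEnergy, intervalIntegral.integral_same, zero_add, sub_zero] at h

lemma norm_sub_sq_le_two_mul {E : Type*} [SeminormedAddCommGroup E] (x y : E) :
    ‖x - y‖ ^ 2 ≤ 2 * ‖x‖ ^ 2 + 2 * ‖y‖ ^ 2 := by
  nlinarith [norm_sub_le x y, norm_nonneg (x - y), sq_nonneg (‖x‖ - ‖y‖), norm_nonneg x,
    norm_nonneg y]

lemma IsPhaseFlow.obsEnergy_sub_le (hS : IsPhaseFlow b φ S) (G : H →L[ℂ] H) {T : ℝ} (hT : 0 ≤ T)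
    {u v : H} (hu : b.repr u 0 = 0) (hv : b.repr v 0 = 0) :
    obsEnergy G S T (u - v) ≤ 2 * obsEnergy G S T u + 2 * obsEnergy G S T v := by
  have huv : b.repr (u - v) 0 = 0 := by simp [hu, hv]
  rw [obsEnergy, obsEnergy, obsEnergy, ← intervalIntegral.integral_const_mul,
    ← intervalIntegral.integral_const_mul, ← intervalIntegral.integral_add]
  · refine intervalIntegral.integral_mono_on hT
      ((hS.continuous_norm_sq G huv).intervalIntegrable _ _)
      ((((hS.continuous_norm_sq G hu).const_mul 2).add
        ((hS.continuous_norm_sq G hv).const_mul 2)).intervalIntegrable _ _) fun t _ => ?_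
    rw [map_sub, map_sub]
    exact norm_sub_sq_le_two_mul _ _
  · exact ((hS.continuous_norm_sq G hu).const_mul 2).intervalIntegrable _ _
  · exact ((hS.continuous_norm_sq G hv).const_mul 2).intervalIntegrable _ _

lemma IsPhaseFlow.obsEnergy_translate_le (hS : IsPhaseFlow b φ S) (G : H →L[ℂ] H) {T s δ μ : ℝ}
    (hT : 0 ≤ T) (hs : 0 ≤ s) (hsδ : s ≤ δ) {u : H} (hu : b.repr u 0 = 0) :
    obsEnergy G S T (Complex.exp (Complex.I * s * (-μ : ℝ)) • S s u) ≤
      obsEnergy G S (T + δ) u := by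
  have h : ∀ t, ‖G (S t (Complex.exp (Complex.I * s * (-μ : ℝ)) • S s u))‖ ^ 2 =
      ‖G (S (t + s) u)‖ ^ 2 := fun t => by
    rw [map_smul, map_smul, norm_smul, norm_exp_I_mul_mul, one_mul, hS.apply_apply t s hu]
  rw [obsEnergy]
  simp only [h]
  rw [intervalIntegral.integral_comp_add_right fun t => ‖G (S t u)‖ ^ 2, zero_add]
  exact intervalIntegral.integral_mono_interval hs (by linarith) (by linarith)
    (Eventually.of_forall fun _ => by positivity)
    ((hS.continuous_norm_sq G hu).intervalIntegrable _ _)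

end Energy

/-- The mean over `s ∈ [0, δ]` of `|e^{isx} - 1|²`. -/
def filterWeight (δ x : ℝ) : ℝ :=
  δ⁻¹ * ∫ s in (0 : ℝ)..δ, ‖Complex.exp (Complex.I * s * x) - 1‖ ^ 2

lemma filterWeight_zero (δ : ℝ) : filterWeight δ 0 = 0 := by
  simp [filterWeight]

lemma filterWeight_nonneg {δ : ℝ} (hδ : 0 < δ) (x : ℝ) : 0 ≤ filterWeight δ x :=
  mul_nonneg (inv_nonneg.2 hδ.le)
    (intervalIntegral.integral_nonneg hδ.le fun _ _ => by positivity)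

lemma one_le_filterWeight {δ x : ℝ} (hδ : 0 < δ) (hx : 2 ≤ |x| * δ) : 1 ≤ filterWeight δ x := by
  have hx0 : x ≠ 0 := by
    rintro rfl
    simp at hx
    linarith
  have h : ∀ s : ℝ, ‖Complex.exp (Complex.I * s * x) - 1‖ ^ 2 = 2 - 2 * Real.cos (x * s) := by
    intro s
    rw [show Complex.I * s * x = ((x * s : ℝ) : ℂ) * Complex.I by push_cast; ring,
      ← Complex.normSq_eq_norm_sq, Complex.normSq_apply]
    simp only [Complex.sub_re, Complex.sub_im, Complex.exp_ofReal_mul_I_re,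
      Complex.exp_ofReal_mul_I_im, Complex.one_re, Complex.one_im]
    nlinarith [Real.sin_sq_add_cos_sq (x * s)]
  have hint : ∫ s in (0 : ℝ)..δ, ‖Complex.exp (Complex.I * s * x) - 1‖ ^ 2 =
      2 * δ - 2 * (x⁻¹ * Real.sin (x * δ)) := by
    simp only [h]
    rw [intervalIntegral.integral_sub (by simp)
      (Continuous.intervalIntegrable (by fun_prop) _ _), intervalIntegral.integral_const_mul,
      intervalIntegral.integral_comp_mul_left _ hx0, integral_cos]
    simp
    ring
  have hsin : x⁻¹ * Real.sin (x * δ) ≤ δ / 2 := by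
    refine (le_abs_self _).trans ?_
    rw [abs_mul, abs_inv, inv_mul_le_iff₀ (abs_pos.2 hx0)]
    linarith [Real.abs_sin_le_one (x * δ)]
  rw [filterWeight, hint, le_inv_mul_iff₀ hδ]
  linarith

/-- Successive averaged differences annihilate the phases listed in `L` at the cost of an
observation time longer by `δ` for each of them. -/
lemma IsPhaseFlow.sum_filterWeight_le {b : HilbertBasis ℤ ℂ H} {φ : ℤ → ℝ} {S : ℝ → H →L[ℂ] H}
    (hS : IsPhaseFlow b φ S) (G : H →L[ℂ] H) (F : Finset ℤ) {C T δ : ℝ} (hC : 0 ≤ C)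
    (hT : 0 ≤ T) (hδ : 0 < δ)
    (h : ∀ u : H, b.repr u 0 = 0 →
      ‖u‖ ^ 2 ≤ C * obsEnergy G S T u + C * ∑ k ∈ F, ‖b.repr u k‖ ^ 2)
    (L : List ℝ) (K : Finset ℤ) {u : H} (hu : b.repr u 0 = 0) :
    ∑ k ∈ K, (L.map fun μ => filterWeight δ (φ k - μ)).prod * ‖b.repr u k‖ ^ 2 ≤
      C * (4 ^ L.length * obsEnergy G S (T + L.length * δ) u) +
        C * ∑ k ∈ F, (L.map fun μ => filterWeight δ (φ k - μ)).prod * ‖b.repr u k‖ ^ 2 := by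
  induction L generalizing u with
  | nil => simpa using (b.sum_norm_sq_repr_le u K).trans (h u hu)
  | cons μ L ih =>
    set W : ℤ → ℝ := fun k => (L.map fun μ => filterWeight δ (φ k - μ)).prod
    set v : ℝ → H := fun s => Complex.exp (Complex.I * s * (-μ : ℝ)) • S s u - u with hv
    have hvk : ∀ s k, ‖b.repr (v s) k‖ ^ 2 =
        ‖Complex.exp (Complex.I * s * (φ k - μ : ℝ)) - 1‖ ^ 2 * ‖b.repr u k‖ ^ 2 := by
      intro s k
      rw [← mul_pow, ← norm_mul, hv, map_sub, map_smul, lp.coeFn_sub, lp.coeFn_smul,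
        Pi.sub_apply, Pi.smul_apply, hS s u hu, smul_eq_mul, ← mul_assoc, ← Complex.exp_add,
        sub_mul, one_mul]
      congr 6
      push_cast
      ring
    have hv0 : ∀ s, b.repr (v s) 0 = 0 := fun s => by
      have := hvk s 0
      rw [hu] at this
      simpa using this
    set E := obsEnergy G S (T + L.length * δ + δ) u with hE
    have hTL : 0 ≤ T + L.length * δ := by positivity
    have hEv : ∀ s ∈ Set.Icc 0 δ, obsEnergy G S (T + L.length * δ) (v s) ≤ 4 * E := by
      intro s hs
      have h0 : b.repr (Complex.exp (Complex.I * s * (-μ : ℝ)) • S s u) 0 = 0 := by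
        simp [hS.repr_zero s hu]
      have h1 := hS.obsEnergy_sub_le G hTL h0 hu
      have h2 := hS.obsEnergy_translate_le G (μ := μ) hTL hs.1 hs.2 hu
      have h3 := hS.obsEnergy_mono G hTL (by linarith : _ ≤ T + L.length * δ + δ) hu
      linarith
    have hsum : ∀ A : Finset ℤ, Continuous fun s : ℝ => ∑ k ∈ A, W k *
        (‖Complex.exp (Complex.I * s * (φ k - μ : ℝ)) - 1‖ ^ 2 * ‖b.repr u k‖ ^ 2) :=
      fun A => by fun_prop
    have hintsum : ∀ A : Finset ℤ, ∫ s in (0 : ℝ)..δ, ∑ k ∈ A, W k *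
        (‖Complex.exp (Complex.I * s * (φ k - μ : ℝ)) - 1‖ ^ 2 * ‖b.repr u k‖ ^ 2) =
        δ * ∑ k ∈ A, (filterWeight δ (φ k - μ) * W k) * ‖b.repr u k‖ ^ 2 := by
      intro A
      rw [intervalIntegral.integral_finsetSum fun k _ =>
        Continuous.intervalIntegrable (by fun_prop) _ _, Finset.mul_sum]
      refine Finset.sum_congr rfl fun k _ => ?_
      rw [intervalIntegral.integral_const_mul, intervalIntegral.integral_mul_const, filterWeight]
      simp only [mul_assoc]
      rw [mul_inv_cancel_left₀ hδ.ne']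
      ring
    have hle : ∀ s ∈ Set.Icc 0 δ, ∑ k ∈ K, W k *
        (‖Complex.exp (Complex.I * s * (φ k - μ : ℝ)) - 1‖ ^ 2 * ‖b.repr u k‖ ^ 2) ≤
        C * (4 ^ L.length * (4 * E)) + C * ∑ k ∈ F, W k *
        (‖Complex.exp (Complex.I * s * (φ k - μ : ℝ)) - 1‖ ^ 2 * ‖b.repr u k‖ ^ 2) := by
      intro s hs
      have h1 := ih (hv0 s)
      simp only [hvk] at h1
      refine h1.trans ?_
      gcongr
      exact hEv s hs
    have hI := intervalIntegral.integral_mono_on (μ := volume) hδ.le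
      ((hsum K).intervalIntegrable _ _)
      ((continuous_const.add ((hsum F).const_mul C)).intervalIntegrable _ _) hle
    simp only [Pi.add_apply] at hI
    rw [intervalIntegral.integral_add intervalIntegrable_const
      (((hsum F).const_mul C).intervalIntegrable _ _), intervalIntegral.integral_const,
      intervalIntegral.integral_const_mul, hintsum, hintsum, smul_eq_mul, sub_zero] at hI
    simp only [List.map_cons, List.prod_cons, List.length_cons]
    have hE' : T + ((L.length + 1 : ℕ) : ℝ) * δ = T + L.length * δ + δ := by
      push_cast
      ring
    rw [hE', ← hE, pow_succ]
    refine le_of_mul_le_mul_left (hI.trans_eq ?_) hδ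
    ring

lemma HilbertBasis.repr_sum_smul (b : HilbertBasis ℤ ℂ H) (F : Finset ℤ) (u : H) (k : ℤ) :
    b.repr (∑ j ∈ F, b.repr u j • b j) k = if k ∈ F then b.repr u k else 0 := by
  simp only [map_sum, map_smul, b.repr_self, lp.coeFn_sum, Finset.sum_apply, lp.coeFn_smul,
    Pi.smul_apply, smul_eq_mul, lp.single_apply, Pi.single_apply, mul_ite, mul_one, mul_zero]
  rw [Finset.sum_ite_eq]

/-- A bounded operator without nonzero mean-zero trigonometric polynomials in its kernel is
bounded below on each finite set of nonzero modes. -/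
lemma HilbertBasis.exists_norm_le_of_finite_modes (b : HilbertBasis ℤ ℂ H) (G : H →L[ℂ] H)
    (hinj : ∀ F : Finset ℤ, ∀ u : H, b.repr u 0 = 0 → (∀ k ∉ F, b.repr u k = 0) →
      G u = 0 → u = 0) {F : Finset ℤ} (hF : (0 : ℤ) ∉ F) :
    ∃ c : ℝ, 0 < c ∧ ∀ u : H, (∀ k ∉ F, b.repr u k = 0) → ‖u‖ ≤ c * ‖G u‖ := by
  let V : Submodule ℂ H :=
    { carrier := {u | ∀ k ∉ F, b.repr u k = 0}
      add_mem' := fun {u v} hu hv k hk => by simp [hu k hk, hv k hk]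
      zero_mem' := fun k _ => by simp
      smul_mem' := fun c u hu k hk => by simp [hu k hk] }
  let f : V →ₗ[ℂ] (F → ℂ) :=
    { toFun := fun u k => b.repr (u : H) k
      map_add' := fun u v => by ext; simp
      map_smul' := fun c u => by ext; simp }
  have hf : Function.Injective f := fun u v huv => by
    refine Subtype.ext (b.ext_repr fun k => ?_)
    by_cases hk : k ∈ F
    · exact congrFun huv ⟨k, hk⟩
    · rw [u.2 k hk, v.2 k hk]
  have : FiniteDimensional ℂ V := Module.Finite.of_injective f hf
  obtain ⟨c, hc, hanti⟩ := (G.toLinearMap.domRestrict V).exists_antilipschitzWith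
    (LinearMap.ker_eq_bot'.2 fun u hu => Subtype.ext (hinj F u (u.2 0 hF) u.2 hu))
  refine ⟨c, hc, fun u hu => ?_⟩
  have h := hanti.le_mul_dist ⟨u, hu⟩ 0
  rwa [dist_zero_right, map_zero, dist_zero_right] at h

/-- The dispersion relation of `∂ₜu + ∂ₓ³u - λ²∂ₓ⁻¹u = 0`. -/
def lamPhase (lam : ℝ) (k : ℤ) : ℝ := (k : ℝ) ^ 3 - lam ^ 2 / k

lemma abs_lamPhase_le {lam Lam : ℝ} (h0 : 0 ≤ lam) (h : lam ≤ Lam) (k : ℤ) :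
    |lamPhase lam k| ≤ |(k : ℝ)| ^ 3 + Lam ^ 2 := by
  refine (abs_sub _ _).trans ?_
  rw [abs_pow, abs_div, abs_of_nonneg (sq_nonneg lam)]
  have hsq : lam ^ 2 ≤ Lam ^ 2 := by gcongr
  rcases eq_or_ne k 0 with rfl | hk
  · simp
    positivity
  · have h1 : (1 : ℝ) ≤ |(k : ℝ)| := by exact_mod_cast Int.one_le_abs hk
    gcongr
    exact (div_le_self (sq_nonneg _) h1).trans hsq

lemma le_abs_lamPhase {lam Lam : ℝ} (h0 : 0 ≤ lam) (h : lam ≤ Lam) {k : ℤ} (hk : k ≠ 0) :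
    |(k : ℝ)| - Lam ^ 2 ≤ |lamPhase lam k| := by
  have h1 : (1 : ℝ) ≤ |(k : ℝ)| := by exact_mod_cast Int.one_le_abs hk
  have hsq : lam ^ 2 ≤ Lam ^ 2 := by gcongr
  have h2 := abs_sub_abs_le_abs_sub ((k : ℝ) ^ 3) (lam ^ 2 / k)
  rw [abs_pow, abs_div, abs_of_nonneg (sq_nonneg lam)] at h2
  have h3 : lam ^ 2 / |(k : ℝ)| ≤ Lam ^ 2 := (div_le_self (sq_nonneg _) h1).trans hsq
  have h4 : |(k : ℝ)| ≤ |(k : ℝ)| ^ 3 := le_self_pow₀ h1 (by norm_num)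
  rw [lamPhase]
  linarith

lemma tendsto_abs_lamPhase_sub {j k : ℤ} (hjk : j ≠ k) :
    Tendsto (fun lam => |lamPhase lam j - lamPhase lam k|) atTop atTop := by
  have hne : ((k : ℝ)⁻¹ - (j : ℝ)⁻¹) ≠ 0 := by
    rw [sub_ne_zero]
    exact fun h => hjk (by exact_mod_cast (inv_injective h).symm)
  have h1 : Tendsto (fun lam : ℝ => lam ^ 2 * |(k : ℝ)⁻¹ - (j : ℝ)⁻¹| - |(j : ℝ) ^ 3 - (k : ℝ) ^ 3|)
      atTop atTop :=
    tendsto_atTop_add_const_right _ _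
      ((tendsto_pow_atTop two_ne_zero).atTop_mul_const (abs_pos.2 hne))
  refine tendsto_atTop_mono (fun lam => ?_) h1
  have h2 := abs_sub_abs_le_abs_sub (lam ^ 2 * ((k : ℝ)⁻¹ - (j : ℝ)⁻¹))
    (-((j : ℝ) ^ 3 - (k : ℝ) ^ 3))
  rw [abs_mul, abs_of_nonneg (sq_nonneg lam), abs_neg] at h2
  refine h2.trans_eq ?_
  rw [lamPhase, lamPhase]
  congr 1
  ring

lemma exists_sep_lamPhase (F : Finset ℤ) {Lam : ℝ} (R : ℝ) :
    ∃ N : ℕ, ∀ lam, 0 ≤ lam → lam ≤ Lam → ∀ k : ℤ, k ≠ 0 → k ∉ Finset.Icc (-N : ℤ) N →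
      ∀ j ∈ F, R ≤ |lamPhase lam k - lamPhase lam j| := by
  obtain ⟨N, hN⟩ := exists_nat_ge (R + 2 * Lam ^ 2 + ∑ j ∈ F, |(j : ℝ)| ^ 3)
  refine ⟨N, fun lam h0 h k hk hkN j hj => ?_⟩
  have h1 := le_abs_lamPhase h0 h hk
  have h2 := abs_lamPhase_le h0 h j
  have h3 : |(j : ℝ)| ^ 3 ≤ ∑ j ∈ F, |(j : ℝ)| ^ 3 :=
    Finset.single_le_sum (f := fun j : ℤ => |(j : ℝ)| ^ 3) (fun _ _ => by positivity) hj
  have h4 : (N : ℝ) ≤ |(k : ℝ)| := by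
    have : (N : ℤ) ≤ |k| := by
      rw [Finset.mem_Icc, ← abs_le] at hkN
      omega
    exact_mod_cast this
  have h5 := abs_sub_abs_le_abs_sub (lamPhase lam k) (lamPhase lam j)
  linarith

/-- Uniform observability for `λ` in a bounded range, given observability modulo finitely many
modes in a shorter time. -/
lemma exists_obs_of_le (b : HilbertBasis ℤ ℂ H) (G : H →L[ℂ] H)
    (hinj : ∀ F : Finset ℤ, ∀ u : H, b.repr u 0 = 0 → (∀ k ∉ F, b.repr u k = 0) →
      G u = 0 → u = 0)
    {T' T C : ℝ} (hT' : 0 < T') (hTT' : T' < T) (hC : 0 ≤ C) (F : Finset ℤ)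
    (h : ∀ lam : ℝ, 0 ≤ lam → ∀ S : ℝ → H →L[ℂ] H, IsPhaseFlow b (lamPhase lam) S →
      ∀ u : H, b.repr u 0 = 0 →
        ‖u‖ ^ 2 ≤ C * obsEnergy G S T' u + C * ∑ k ∈ F, ‖b.repr u k‖ ^ 2) (Lam : ℝ) :
    ∃ C' : ℝ, 0 < C' ∧ ∀ lam : ℝ, 0 ≤ lam → lam ≤ Lam →
      ∀ S : ℝ → H →L[ℂ] H, IsPhaseFlow b (lamPhase lam) S →
        ∀ u : H, b.repr u 0 = 0 → ‖u‖ ^ 2 ≤ C' * obsEnergy G S T u := by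
  have hT : 0 < T := hT'.trans hTT'
  set δ : ℝ := (T - T') / (F.card + 1)
  have hδ : 0 < δ := div_pos (sub_pos.2 hTT') (by positivity)
  have htime : T' + F.card * δ ≤ T := by
    have : (F.card + 1) * δ = T - T' := mul_div_cancel₀ _ (by positivity)
    linarith
  obtain ⟨N, hN⟩ := exists_sep_lamPhase F (Lam := Lam) (2 / δ)
  set F' : Finset ℤ := (Finset.Icc (-N : ℤ) N).erase 0 with hF'
  have hF'0 : (0 : ℤ) ∉ F' := by simp [hF']
  obtain ⟨c, hc, hcG⟩ := b.exists_norm_le_of_finite_modes G hinj hF'0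
  set R : ℝ := C * 4 ^ F.card with hR
  have hR0 : 0 ≤ R := by positivity
  refine ⟨2 * (c ^ 2 / T * (2 + 2 * (T * ‖G‖ ^ 2 * R))) + 2 * R, by positivity, ?_⟩
  intro lam h0 hlam S hS u hu
  set φ := lamPhase lam
  set E := obsEnergy G S T u
  set P : ℤ → ℝ := fun k => ∏ j ∈ F, filterWeight δ (φ k - φ j)
  have hP0 : ∀ k, 0 ≤ P k := fun k => Finset.prod_nonneg fun _ _ => filterWeight_nonneg hδ _
  have hfilter : ∀ K : Finset ℤ, ∑ k ∈ K, P k * ‖b.repr u k‖ ^ 2 ≤ R * E := by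
    intro K
    have h1 := hS.sum_filterWeight_le G F hC hT'.le hδ (h lam h0 S hS) (F.toList.map φ) K hu
    simp only [List.map_map, Function.comp_def, Finset.prod_map_toList, List.length_map,
      Finset.length_toList] at h1
    have h2 : ∑ k ∈ F, (∏ j ∈ F, filterWeight δ (φ k - φ j)) * ‖b.repr u k‖ ^ 2 = 0 :=
      Finset.sum_eq_zero fun k hk => by
        rw [Finset.prod_eq_zero hk (by rw [sub_self, filterWeight_zero]), zero_mul]
    rw [h2, mul_zero, add_zero, ← mul_assoc, ← hR] at h1
    refine h1.trans ?_
    gcongr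
    exact hS.obsEnergy_mono G (by positivity) htime hu
  have hP1 : ∀ k, k ≠ 0 → k ∉ F' → 1 ≤ P k := by
    intro k hk hkF'
    have hkN : k ∉ Finset.Icc (-N : ℤ) N := fun hmem => hkF' (Finset.mem_erase.2 ⟨hk, hmem⟩)
    calc (1 : ℝ) = ∏ j ∈ F, (1 : ℝ) := by simp
      _ ≤ P k := Finset.prod_le_prod (fun _ _ => zero_le_one) fun j hj =>
        one_le_filterWeight hδ ((div_le_iff₀ hδ).1 (hN lam h0 hlam k hk hkN j hj))
  set p : H := ∑ j ∈ F', b.repr u j • b j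
  have hpk : ∀ k, b.repr p k = if k ∈ F' then b.repr u k else 0 := b.repr_sum_smul F' u
  have hp0 : b.repr p 0 = 0 := by rw [hpk, if_neg hF'0]
  have hrk : ∀ k, b.repr (u - p) k = if k ∈ F' then 0 else b.repr u k := by
    intro k
    rw [map_sub, lp.coeFn_sub, Pi.sub_apply, hpk]
    split_ifs <;> simp
  have hr0 : b.repr (u - p) 0 = 0 := by rw [hrk, if_neg hF'0, hu]
  have hr : ‖u - p‖ ^ 2 ≤ R * E := by
    refine b.norm_sq_le_of_sum_le fun K => le_trans (Finset.sum_le_sum fun k _ => ?_) (hfilter K)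
    rw [hrk]
    split_ifs with hk
    · simpa using mul_nonneg (hP0 k) (sq_nonneg ‖b.repr u k‖)
    · rcases eq_or_ne k 0 with rfl | hk0
      · simp [hu]
      · exact le_mul_of_one_le_left (by positivity) (hP1 k hk0 hk)
  have hEp : obsEnergy G S T p ≤ (2 + 2 * (T * ‖G‖ ^ 2 * R)) * E := by
    have h1 := hS.obsEnergy_sub_le G hT.le hu hr0
    rw [sub_sub_cancel] at h1
    have h2 := hS.obsEnergy_le G hT.le hr0
    have h3 : T * (‖G‖ ^ 2 * ‖u - p‖ ^ 2) ≤ T * (‖G‖ ^ 2 * (R * E)) := by gcongr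
    linarith
  have hpn : T * ‖p‖ ^ 2 ≤ c ^ 2 * obsEnergy G S T p := by
    rw [obsEnergy, ← intervalIntegral.integral_const_mul]
    have h1 := intervalIntegral.integral_mono_on (μ := volume) hT.le
      (intervalIntegrable_const (c := ‖p‖ ^ 2))
      (((hS.continuous_norm_sq G hp0).const_mul (c ^ 2)).intervalIntegrable 0 T) fun t _ => by
        rw [← hS.norm_apply t hp0, ← mul_pow]
        gcongr
        exact hcG _ fun k hk => by rw [hS t p hp0, hpk, if_neg hk, mul_zero]
    rwa [intervalIntegral.integral_const, smul_eq_mul, sub_zero] at h1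
  have hpn' : ‖p‖ ^ 2 ≤ c ^ 2 / T * ((2 + 2 * (T * ‖G‖ ^ 2 * R)) * E) := by
    rw [div_mul_eq_mul_div, le_div_iff₀ hT, mul_comm]
    exact hpn.trans (by gcongr)
  have hsum := norm_sub_sq_le_two_mul (u - p) (-p)
  rw [sub_neg_eq_add, sub_add_cancel, norm_neg] at hsum
  linarith

lemma sq_integral_le_mul_integral_sq {f : ℝ → ℝ} (hf : Continuous f) {T : ℝ} (hT : 0 < T) :
    (∫ t in (0 : ℝ)..T, f t) ^ 2 ≤ T * ∫ t in (0 : ℝ)..T, f t ^ 2 := by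
  set m := (∫ t in (0 : ℝ)..T, f t) / T
  have hI : ∫ t in (0 : ℝ)..T, f t = T * m := (mul_div_cancel₀ _ hT.ne').symm
  have h : 0 ≤ ∫ t in (0 : ℝ)..T, (f t ^ 2 - 2 * m * f t + m ^ 2) :=
    intervalIntegral.integral_nonneg hT.le fun t _ => by nlinarith [sq_nonneg (f t - m)]
  rw [intervalIntegral.integral_add (Continuous.intervalIntegrable (by fun_prop) _ _) (by simp),
    intervalIntegral.integral_sub (Continuous.intervalIntegrable (by fun_prop) _ _)
      (Continuous.intervalIntegrable (by fun_prop) _ _),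
    intervalIntegral.integral_const_mul, hI, intervalIntegral.integral_const, smul_eq_mul] at h
  rw [hI]
  nlinarith

lemma norm_integral_exp_I_mul_mul_le {x : ℝ} (hx : x ≠ 0) (T : ℝ) :
    ‖∫ t in (0 : ℝ)..T, Complex.exp (Complex.I * t * x)‖ ≤ 2 / |x| := by
  have hx' : Complex.I * (x : ℂ) ≠ 0 := mul_ne_zero Complex.I_ne_zero (by exact_mod_cast hx)
  have h : ∀ t : ℝ, Complex.exp (Complex.I * t * x) = Complex.exp (Complex.I * x * t) :=
    fun t => by rw [mul_right_comm]
  simp only [h]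
  rw [integral_exp_mul_complex hx', norm_div, norm_mul, Complex.norm_I, one_mul,
    Complex.norm_real, Real.norm_eq_abs, ← h, ← h]
  gcongr
  refine (norm_sub_le _ _).trans ?_
  rw [norm_exp_I_mul_mul, norm_exp_I_mul_mul]
  norm_num

/-- For large `λ` the phases of distinct modes separate, so that a single coefficient can be
recovered from the observation up to a small error. -/
lemma exists_norm_sq_repr_le_of_large [CompleteSpace H] (b : HilbertBasis ℤ ℂ H) (G : H →L[ℂ] H)
    (hinj : ∀ F : Finset ℤ, ∀ u : H, b.repr u 0 = 0 → (∀ k ∉ F, b.repr u k = 0) →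
      G u = 0 → u = 0)
    {T ε : ℝ} (hT : 0 < T) (hε : 0 < ε) {k : ℤ} (hk : k ≠ 0) :
    ∃ A : ℝ, 0 ≤ A ∧ ∀ᶠ lam in atTop, ∀ S : ℝ → H →L[ℂ] H, IsPhaseFlow b (lamPhase lam) S →
      ∀ u : H, b.repr u 0 = 0 →
        ‖b.repr u k‖ ^ 2 ≤ A * obsEnergy G S T u + ε * ‖u‖ ^ 2 := by
  set w := G (b k) with hw
  have hw0 : w ≠ 0 := by
    intro hw0
    have h1 : b k = 0 := hinj {k} (b k)
      (by rw [b.repr_self, lp.single_apply, Pi.single_eq_of_ne hk.symm])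
      (fun j hj => by
        rw [b.repr_self, lp.single_apply, Pi.single_eq_of_ne (Finset.notMem_singleton.1 hj)]) hw0
    have h2 := b.orthonormal.1 k
    rw [h1, norm_zero] at h2
    exact zero_ne_one h2
  set β := ‖w‖ ^ 2 with hβ
  have hβ0 : 0 < β := by positivity
  set B := ContinuousLinearMap.adjoint G w with hB
  have hBk : ‖b.repr B k‖ = β := by
    rw [b.repr_apply_apply, hB, ContinuousLinearMap.adjoint_inner_right, ← hw,
      inner_self_eq_norm_sq_to_K, hβ]
    simp
  set η := β * √(ε / 8) with hη
  have hη0 : 0 < η := by positivity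
  have hη2 : 8 * η ^ 2 = ε * β ^ 2 := by
    rw [hη, mul_pow, Real.sq_sqrt (by positivity)]
    ring
  obtain ⟨M, hkM, hM⟩ : ∃ M : Finset ℤ, k ∈ M ∧ ‖B - ∑ j ∈ M, b.repr B j • b j‖ ≤ η := by
    have h1 := (b.hasSum_repr B).eventually (Metric.ball_mem_nhds B hη0)
    obtain ⟨M, hM1, hM2⟩ := (h1.and (eventually_ge_atTop {k})).exists
    refine ⟨M, Finset.singleton_subset_iff.1 hM2, ?_⟩
    rw [← dist_eq_norm, dist_comm]
    exact (Metric.mem_ball.1 hM1).le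
  have hsmall : ∀ᶠ lam in atTop,
      ∑ j ∈ M.erase k, ‖B‖ * (2 / |lamPhase lam j - lamPhase lam k|) ≤ T * η := by
    have h1 : Tendsto (fun lam => ∑ j ∈ M.erase k,
        ‖B‖ * (2 / |lamPhase lam j - lamPhase lam k|)) atTop (nhds (∑ j ∈ M.erase k, ‖B‖ * 0)) :=
      tendsto_finsetSum _ fun j hj => ((tendsto_abs_lamPhase_sub
        (Finset.ne_of_mem_erase hj)).const_div_atTop 2).const_mul _
    rw [mul_zero, Finset.sum_const_zero] at h1
    exact h1.eventually_le_const (by positivity)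
  have hsep : ∀ᶠ lam in atTop, ∀ j ∈ M.erase k, lamPhase lam j - lamPhase lam k ≠ 0 := by
    rw [eventually_all_finset]
    intro j hj
    filter_upwards [(tendsto_abs_lamPhase_sub
      (Finset.ne_of_mem_erase hj)).eventually_gt_atTop 0] with lam h using abs_pos.1 h
  refine ⟨2 * β / (T * β ^ 2), by positivity, ?_⟩
  filter_upwards [hsmall, hsep] with lam hlam hlam' S hS u hu
  set φ := lamPhase lam
  set r := B - ∑ j ∈ M, b.repr B j • b j with hr
  set e : ℝ → ℂ := fun t => Complex.exp (Complex.I * t * (-φ k : ℝ)) with he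
  have hen : ∀ t, ‖e t‖ = 1 := fun t => norm_exp_I_mul_mul _ _
  have hec : Continuous e := by fun_prop
  have hSc := hS.continuous_apply hu
  set a : ℤ → ℂ := fun j => (starRingEnd ℂ) (b.repr B j) * b.repr u j with ha
  have hdecomp : ∀ t, e t * inner ℂ w (G (S t u)) = e t * inner ℂ r (S t u) +
      (a k + ∑ j ∈ M.erase k, a j * Complex.exp (Complex.I * t * (φ j - φ k : ℝ))) := by
    intro t
    have h1 : inner ℂ w (G (S t u)) = inner ℂ r (S t u) +
        ∑ j ∈ M, (starRingEnd ℂ) (b.repr B j) * b.repr (S t u) j := by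
      rw [← ContinuousLinearMap.adjoint_inner_left, ← hB, hr, inner_sub_left, sum_inner]
      simp only [inner_smul_left, b.repr_apply_apply]
      ring
    have h2 : ∀ j, e t * ((starRingEnd ℂ) (b.repr B j) * b.repr (S t u) j) =
        a j * Complex.exp (Complex.I * t * (φ j - φ k : ℝ)) := by
      intro j
      rw [hS t u hu, he, ha]
      have : Complex.exp (Complex.I * t * (φ j - φ k : ℝ)) =
          Complex.exp (Complex.I * t * (-φ k : ℝ)) * Complex.exp (Complex.I * t * φ j) := by
        rw [← Complex.exp_add]
        congr 1
        push_cast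
        ring
      rw [this]
      ring
    rw [h1, mul_add, Finset.mul_sum, ← Finset.add_sum_erase _ _ hkM]
    simp only [h2]
    simp
  have hi1 : Continuous fun t => e t * inner ℂ w (G (S t u)) :=
    hec.mul (continuous_const.inner (G.continuous.comp hSc))
  have hi2 : Continuous fun t => e t * inner ℂ r (S t u) := hec.mul (continuous_const.inner hSc)
  have hi3 : ∀ j, Continuous fun t : ℝ =>
      a j * Complex.exp (Complex.I * t * (φ j - φ k : ℝ)) := fun j => by fun_prop
  have hi4 : Continuous fun t : ℝ =>
      ∑ j ∈ M.erase k, a j * Complex.exp (Complex.I * t * (φ j - φ k : ℝ)) := by fun_prop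
  have hi5 : Continuous fun t : ℝ =>
      a k + ∑ j ∈ M.erase k, a j * Complex.exp (Complex.I * t * (φ j - φ k : ℝ)) := by fun_prop
  have hint : (T : ℂ) * a k = (∫ t in (0 : ℝ)..T, e t * inner ℂ w (G (S t u))) -
      (∫ t in (0 : ℝ)..T, e t * inner ℂ r (S t u)) -
      ∑ j ∈ M.erase k, a j * ∫ t in (0 : ℝ)..T, Complex.exp (Complex.I * t * (φ j - φ k : ℝ)) := by
    simp only [hdecomp]
    rw [intervalIntegral.integral_add (hi2.intervalIntegrable _ _)
      (hi5.intervalIntegrable _ _),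
      intervalIntegral.integral_add intervalIntegrable_const
      (hi4.intervalIntegrable _ _),
      intervalIntegral.integral_finsetSum fun j _ => (hi3 j).intervalIntegrable _ _,
      intervalIntegral.integral_const]
    simp only [intervalIntegral.integral_const_mul, sub_zero, Complex.real_smul]
    ring
  have hn1 : ‖∫ t in (0 : ℝ)..T, e t * inner ℂ w (G (S t u))‖ ≤
      ‖w‖ * ∫ t in (0 : ℝ)..T, ‖G (S t u)‖ := by
    refine (intervalIntegral.norm_integral_le_integral_norm hT.le).trans ?_
    rw [← intervalIntegral.integral_const_mul]
    refine intervalIntegral.integral_mono_on hT.le (hi1.norm.intervalIntegrable _ _)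
      ((continuous_const.mul (G.continuous.comp hSc).norm).intervalIntegrable _ _) fun t _ => ?_
    rw [norm_mul, hen, one_mul]
    exact norm_inner_le_norm _ _
  have hn2 : ‖∫ t in (0 : ℝ)..T, e t * inner ℂ r (S t u)‖ ≤ T * η * ‖u‖ := by
    refine (intervalIntegral.norm_integral_le_of_norm_le_const (C := η * ‖u‖)
      fun t _ => ?_).trans_eq ?_
    · rw [norm_mul, hen, one_mul, ← hS.norm_apply t hu]
      exact (norm_inner_le_norm _ _).trans (by gcongr)
    · rw [sub_zero, abs_of_pos hT]
      ring
  have hn3 : ‖∑ j ∈ M.erase k,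
      a j * ∫ t in (0 : ℝ)..T, Complex.exp (Complex.I * t * (φ j - φ k : ℝ))‖ ≤ T * η * ‖u‖ := by
    refine (norm_sum_le_of_le _ (f := fun j => a j * ∫ t in (0 : ℝ)..T,
      Complex.exp (Complex.I * t * (φ j - φ k : ℝ)))
      (n := fun j => ‖B‖ * (2 / |φ j - φ k|) * ‖u‖) fun j hj => ?_).trans ?_
    · rw [norm_mul, ha, norm_mul, RCLike.norm_conj, mul_right_comm]
      gcongr
      · exact b.norm_repr_le _ _
      · exact norm_integral_exp_I_mul_mul_le (hlam' j hj) T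
      · exact b.norm_repr_le _ _
    · rw [← Finset.sum_mul]
      gcongr
  set X := ∫ t in (0 : ℝ)..T, ‖G (S t u)‖
  have hX0 : 0 ≤ X := intervalIntegral.integral_nonneg hT.le fun _ _ => norm_nonneg _
  have hX2 : X ^ 2 ≤ T * obsEnergy G S T u :=
    sq_integral_le_mul_integral_sq (G.continuous.comp hSc).norm hT
  have hmain : T * β * ‖b.repr u k‖ ≤ ‖w‖ * X + 2 * (T * η * ‖u‖) := by
    have h1 : T * β * ‖b.repr u k‖ = ‖(T : ℂ) * a k‖ := by
      rw [norm_mul, ha, norm_mul, RCLike.norm_conj, hBk, Complex.norm_real,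
        Real.norm_of_nonneg hT.le, mul_assoc]
    rw [h1, hint]
    refine (norm_sub_le _ _).trans ?_
    have := norm_sub_le (∫ t in (0 : ℝ)..T, e t * inner ℂ w (G (S t u)))
      (∫ t in (0 : ℝ)..T, e t * inner ℂ r (S t u))
    linarith
  have hsq : (T * β * ‖b.repr u k‖) ^ 2 ≤ 2 * (‖w‖ * X) ^ 2 + 2 * (2 * (T * η * ‖u‖)) ^ 2 := by
    refine (pow_le_pow_left₀ (by positivity) hmain 2).trans ?_
    nlinarith [sq_nonneg (‖w‖ * X - 2 * (T * η * ‖u‖))]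
  have hfin : T ^ 2 * β ^ 2 * ‖b.repr u k‖ ^ 2 ≤
      T ^ 2 * β ^ 2 * (2 * β / (T * β ^ 2) * obsEnergy G S T u + ε * ‖u‖ ^ 2) := by
    have h1 : T ^ 2 * β ^ 2 * (2 * β / (T * β ^ 2) * obsEnergy G S T u + ε * ‖u‖ ^ 2) =
        2 * β * (T * obsEnergy G S T u) + T ^ 2 * (ε * β ^ 2) * ‖u‖ ^ 2 := by
      field_simp
    have h2 : 2 * β * X ^ 2 ≤ 2 * β * (T * obsEnergy G S T u) := by gcongr
    rw [h1, ← hη2]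
    calc T ^ 2 * β ^ 2 * ‖b.repr u k‖ ^ 2 = (T * β * ‖b.repr u k‖) ^ 2 := by ring
      _ ≤ _ := hsq
      _ = 2 * β * X ^ 2 + T ^ 2 * (8 * η ^ 2) * ‖u‖ ^ 2 := by rw [hβ]; ring
      _ ≤ _ := by gcongr
  exact le_of_mul_le_mul_left hfin (by positivity)

/-- Observability modulo finitely many modes, uniform in `λ`, improves to full observability. -/
theorem exists_obs_of_obs_mod_finite [CompleteSpace H] (b : HilbertBasis ℤ ℂ H) (G : H →L[ℂ] H)
    (hinj : ∀ F : Finset ℤ, ∀ u : H, b.repr u 0 = 0 → (∀ k ∉ F, b.repr u k = 0) →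
      G u = 0 → u = 0)
    {T C : ℝ} (hT : 0 < T) (hC : 0 < C) (F : Finset ℤ)
    (h : ∀ lam : ℝ, 0 ≤ lam → ∀ S : ℝ → H →L[ℂ] H, IsPhaseFlow b (lamPhase lam) S →
      ∀ u : H, b.repr u 0 = 0 →
        ‖u‖ ^ 2 ≤ C * obsEnergy G S T u + C * ∑ k ∈ F, ‖b.repr u k‖ ^ 2) :
    ∃ C' : ℝ, 0 < C' ∧ ∀ lam : ℝ, 0 ≤ lam →
      ∀ S : ℝ → H →L[ℂ] H, IsPhaseFlow b (lamPhase lam) S →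
        ∀ u : H, b.repr u 0 = 0 → ‖u‖ ^ 2 ≤ C' * obsEnergy G S T u := by
  obtain ⟨T', hT', hTT', hshort⟩ : ∃ T', 0 < T' ∧ T' < T ∧ C * ((T - T') * ‖G‖ ^ 2) ≤ 1 / 2 := by
    have hcont : Tendsto (fun s => C * ((T - s) * ‖G‖ ^ 2)) (nhdsWithin T (Set.Iio T))
        (nhds 0) := by
      have : Continuous fun s => C * ((T - s) * ‖G‖ ^ 2) := by fun_prop
      simpa using (this.tendsto T).mono_left nhdsWithin_le_nhds
    obtain ⟨s, hs1, hs2⟩ := ((hcont.eventually_le_const one_half_pos).and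
      (Ioo_mem_nhdsLT hT)).exists
    exact ⟨s, hs2.1, hs2.2, hs1⟩
  have h' : ∀ lam : ℝ, 0 ≤ lam → ∀ S : ℝ → H →L[ℂ] H, IsPhaseFlow b (lamPhase lam) S →
      ∀ u : H, b.repr u 0 = 0 →
        ‖u‖ ^ 2 ≤ 2 * C * obsEnergy G S T' u + 2 * C * ∑ k ∈ F, ‖b.repr u k‖ ^ 2 := by
    intro lam h0 S hS u hu
    have h1 := h lam h0 S hS u hu
    have h2 := mul_le_mul_of_nonneg_left (hS.obsEnergy_le_add G hTT'.le hu) hC.le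
    have h3 := mul_le_mul_of_nonneg_right hshort (sq_nonneg ‖u‖)
    linarith
  set ε : ℝ := 1 / (2 * C * (F.card + 1)) with hε
  have hε0 : 0 < ε := by positivity
  have hlow : ∀ k : ℤ, ∃ A : ℝ, 0 ≤ A ∧ ∀ᶠ lam in atTop, ∀ S : ℝ → H →L[ℂ] H,
      IsPhaseFlow b (lamPhase lam) S → ∀ u : H, b.repr u 0 = 0 →
        ‖b.repr u k‖ ^ 2 ≤ A * obsEnergy G S T u + ε * ‖u‖ ^ 2 := by
    intro k
    rcases eq_or_ne k 0 with rfl | hk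
    · refine ⟨0, le_rfl, Eventually.of_forall fun lam S _ u hu => ?_⟩
      simp [hu]
      positivity
    · exact exists_norm_sq_repr_le_of_large b G hinj hT hε0 hk
  choose A hA0 hA using hlow
  obtain ⟨Lam, hLam⟩ := eventually_atTop.1 ((eventually_all_finset F).2 fun k _ => hA k)
  obtain ⟨C₁, hC₁, hle⟩ := exists_obs_of_le b G hinj hT' hTT' (by positivity) F h' Lam
  have hAs : 0 ≤ ∑ k ∈ F, A k := Finset.sum_nonneg fun k _ => hA0 k
  refine ⟨C₁ + 2 * (C * (1 + ∑ k ∈ F, A k)), by positivity, fun lam h0 S hS u hu => ?_⟩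
  have hE := obsEnergy_nonneg G S hT.le u
  rcases le_total lam Lam with hl | hl
  · refine (hle lam h0 hl S hS u hu).trans ?_
    gcongr
    exact le_add_of_nonneg_right (by positivity)
  · have h1 := h lam h0 S hS u hu
    have h2 : ∑ k ∈ F, ‖b.repr u k‖ ^ 2 ≤
        (∑ k ∈ F, A k) * obsEnergy G S T u + F.card * (ε * ‖u‖ ^ 2) := by
      rw [Finset.sum_mul, ← nsmul_eq_mul, ← Finset.sum_const, ← Finset.sum_add_distrib]
      exact Finset.sum_le_sum fun k hk => hLam lam hl k hk S hS u hu
    have h3 : C * (F.card * (ε * ‖u‖ ^ 2)) ≤ 1 / 2 * ‖u‖ ^ 2 := by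
      have : C * (F.card * ε) ≤ 1 / 2 := by
        rw [hε, mul_one_div, mul_div_assoc', div_le_div_iff₀ (by positivity) two_pos]
        nlinarith
      calc _ = C * (F.card * ε) * ‖u‖ ^ 2 := by ring
        _ ≤ _ := by gcongr
    have h4 := mul_le_mul_of_nonneg_left h2 hC.le
    have h5 : 0 ≤ C₁ * obsEnergy G S T u := by positivity
    linarith


lemma HilbertBasis.exists_tsum_le_sum_add (b : HilbertBasis ℤ ℂ H) {η : ℝ} (hη : 0 < η) :
    ∃ F : Finset ℤ, ∀ u : H, ∑' k : ℤ, (1 + (k : ℝ) ^ 2)⁻¹ * ‖b.repr u k‖ ^ 2 ≤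
      ∑ k ∈ F, ‖b.repr u k‖ ^ 2 + η * ‖u‖ ^ 2 := by
  obtain ⟨N, hN⟩ := exists_nat_ge (1 / η)
  refine ⟨Finset.Icc (-N : ℤ) N, fun u => ?_⟩
  have h1 : HasSum (fun k => if k ∈ Finset.Icc (-N : ℤ) N then ‖b.repr u k‖ ^ 2 else 0)
      (∑ k ∈ Finset.Icc (-N : ℤ) N, ‖b.repr u k‖ ^ 2) := by
    rw [Finset.sum_congr rfl fun k hk => (if_pos hk).symm]
    exact hasSum_sum_of_ne_finset_zero fun k hk => if_neg hk
  have h2 := h1.add ((b.hasSum_norm_sq_repr u).mul_left η)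
  have hle : ∀ k : ℤ, (1 + (k : ℝ) ^ 2)⁻¹ * ‖b.repr u k‖ ^ 2 ≤
      (if k ∈ Finset.Icc (-N : ℤ) N then ‖b.repr u k‖ ^ 2 else 0) + η * ‖b.repr u k‖ ^ 2 := by
    intro k
    split_ifs with hk
    · have h3 : (1 + (k : ℝ) ^ 2)⁻¹ ≤ 1 := inv_le_one_of_one_le₀ (by nlinarith [sq_nonneg (k : ℝ)])
      have h4 := mul_le_mul_of_nonneg_right h3 (sq_nonneg ‖b.repr u k‖)
      have h5 : 0 ≤ η * ‖b.repr u k‖ ^ 2 := by positivity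
      linarith
    · rw [zero_add]
      gcongr
      have hk' : (N : ℤ) < |k| := by
        rw [Finset.mem_Icc, ← abs_le] at hk
        exact not_le.1 hk
      have hk1 : (N : ℝ) + 1 ≤ |(k : ℝ)| := by exact_mod_cast hk'
      rw [inv_le_comm₀ (by positivity) hη, ← sq_abs, ← one_div]
      have : (0 : ℝ) ≤ N := N.cast_nonneg
      nlinarith
  exact hasSum_le hle (Summable.of_nonneg_of_le (fun k => by positivity) hle h2.summable).hasSum h2

lemma HilbertBasis.exists_norm_inner_sq_le (b : HilbertBasis ℤ ℂ H) (γ : H) {η : ℝ} (hη : 0 < η) :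
    ∃ F : Finset ℤ, ∀ v : H, ‖inner ℂ γ v‖ ^ 2 ≤
      2 * ‖γ‖ ^ 2 * ∑ k ∈ F, ‖b.repr v k‖ ^ 2 + η * ‖v‖ ^ 2 := by
  obtain ⟨F, hF⟩ := ((Metric.tendsto_nhds.1 (b.hasSum_repr γ)) (√(η / 2)) (by positivity)).exists
  refine ⟨F, fun v => ?_⟩
  set γF := ∑ k ∈ F, b.repr γ k • b k with hγF
  have hd : ‖γ - γF‖ ^ 2 ≤ η / 2 := by
    rw [dist_comm, dist_eq_norm] at hF
    exact (Real.le_sqrt (norm_nonneg _) (by positivity)).1 hF.le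
  have h1 : ‖inner ℂ γF v‖ ^ 2 ≤ ‖γ‖ ^ 2 * ∑ k ∈ F, ‖b.repr v k‖ ^ 2 := by
    have : ‖inner ℂ γF v‖ ≤ ∑ k ∈ F, ‖b.repr γ k‖ * ‖b.repr v k‖ := by
      rw [hγF, sum_inner]
      refine (norm_sum_le _ _).trans (Finset.sum_le_sum fun k _ => ?_)
      rw [inner_smul_left, ← b.repr_apply_apply, norm_mul, RCLike.norm_conj]
    calc _ ≤ (∑ k ∈ F, ‖b.repr γ k‖ * ‖b.repr v k‖) ^ 2 := by gcongr
      _ ≤ (∑ k ∈ F, ‖b.repr γ k‖ ^ 2) * ∑ k ∈ F, ‖b.repr v k‖ ^ 2 :=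
        Finset.sum_mul_sq_le_sq_mul_sq _ _ _
      _ ≤ _ := by
        gcongr
        exact b.sum_norm_sq_repr_le γ F
  have h2 : ‖inner ℂ (γ - γF) v‖ ^ 2 ≤ η / 2 * ‖v‖ ^ 2 :=
    calc _ ≤ (‖γ - γF‖ * ‖v‖) ^ 2 := by
          gcongr
          exact norm_inner_le_norm _ _
      _ ≤ _ := by
        rw [mul_pow]
        gcongr
  have h3 : ‖inner ℂ γ v‖ ≤ ‖inner ℂ γF v‖ + ‖inner ℂ (γ - γF) v‖ := by
    refine le_of_eq_of_le ?_ (norm_add_le _ _)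
    rw [← inner_add_left, add_sub_cancel]
  calc _ ≤ (‖inner ℂ γF v‖ + ‖inner ℂ (γ - γF) v‖) ^ 2 := by gcongr
    _ ≤ 2 * (‖inner ℂ γF v‖ ^ 2 + ‖inner ℂ (γ - γF) v‖ ^ 2) := add_sq_le
    _ ≤ _ := by linarith

lemma exists_obs_mod_finite_of_weak_obs (b : HilbertBasis ℤ ℂ H) (G : H →L[ℂ] H) (γ : H)
    (q : H → ℝ) {κ : ℝ} (hκ : 0 ≤ κ) (hq0 : ∀ v, 0 ≤ q v)
    (hq : ∀ v, q v ≤ 2 * ‖G v‖ ^ 2 + κ * ‖inner ℂ γ v‖ ^ 2) {T C : ℝ} (hT : 0 < T) (hC : 0 < C)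
    (h : ∀ lam, 0 ≤ lam → ∀ S, IsPhaseFlow b (lamPhase lam) S → ∀ u, b.repr u 0 = 0 →
      ‖u‖ ^ 2 ≤ C * (∫ t in (0 : ℝ)..T, q (S t u)) +
        C * ∑' k : ℤ, (1 + (k : ℝ) ^ 2)⁻¹ * ‖b.repr u k‖ ^ 2) :
    ∃ C₁, 0 < C₁ ∧ ∃ F : Finset ℤ, ∀ lam, 0 ≤ lam → ∀ S, IsPhaseFlow b (lamPhase lam) S →
      ∀ u, b.repr u 0 = 0 →
        ‖u‖ ^ 2 ≤ C₁ * obsEnergy G S T u + C₁ * ∑ k ∈ F, ‖b.repr u k‖ ^ 2 := by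
  set η : ℝ := 1 / (2 * (C * κ * T + C)) with hη
  have hη0 : 0 < η := by positivity
  obtain ⟨F₁, hF₁⟩ := b.exists_tsum_le_sum_add hη0
  obtain ⟨F₂, hF₂⟩ := b.exists_norm_inner_sq_le γ hη0
  refine ⟨2 * (2 * C + 2 * C * κ * T * ‖γ‖ ^ 2 + C), by positivity, F₁ ∪ F₂,
    fun lam h0 S hS u hu => ?_⟩
  set σ := ∑ k ∈ F₁ ∪ F₂, ‖b.repr u k‖ ^ 2
  have hσ0 : 0 ≤ σ := Finset.sum_nonneg fun _ _ => by positivity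
  have h1 : ∑ k ∈ F₁, ‖b.repr u k‖ ^ 2 ≤ σ :=
    Finset.sum_le_sum_of_subset_of_nonneg Finset.subset_union_left fun _ _ _ => by positivity
  have h2 : ∑ k ∈ F₂, ‖b.repr u k‖ ^ 2 ≤ σ :=
    Finset.sum_le_sum_of_subset_of_nonneg Finset.subset_union_right fun _ _ _ => by positivity
  have hin : ∀ t, ‖inner ℂ γ (S t u)‖ ^ 2 ≤ 2 * ‖γ‖ ^ 2 * σ + η * ‖u‖ ^ 2 := by
    intro t
    refine (hF₂ (S t u)).trans ?_
    simp only [hS.norm_repr t hu, hS.norm_apply t hu]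
    gcongr
  have hint : ∫ t in (0 : ℝ)..T, q (S t u) ≤
      2 * obsEnergy G S T u + T * (κ * (2 * ‖γ‖ ^ 2 * σ + η * ‖u‖ ^ 2)) := by
    have hcG : IntervalIntegrable (fun t => 2 * ‖G (S t u)‖ ^ 2) volume 0 T :=
      ((hS.continuous_norm_sq G hu).const_mul 2).intervalIntegrable _ _
    have hcI : IntervalIntegrable (fun t => 2 * ‖G (S t u)‖ ^ 2 +
        κ * (2 * ‖γ‖ ^ 2 * σ + η * ‖u‖ ^ 2)) volume 0 T := hcG.add intervalIntegrable_const
    calc _ ≤ ∫ t in (0 : ℝ)..T, (2 * ‖G (S t u)‖ ^ 2 +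
          κ * (2 * ‖γ‖ ^ 2 * σ + η * ‖u‖ ^ 2)) := by
          rw [intervalIntegral.integral_of_le hT.le, intervalIntegral.integral_of_le hT.le]
          refine integral_mono_of_nonneg (Eventually.of_forall fun t => hq0 _) hcI.1
            (Eventually.of_forall fun t => (hq _).trans ?_)
          have := hin t
          dsimp only
          gcongr
      _ = _ := by
          rw [intervalIntegral.integral_add hcG intervalIntegrable_const,
            intervalIntegral.integral_const, intervalIntegral.integral_const_mul, sub_zero,
            smul_eq_mul, obsEnergy]
  have hmain := h lam h0 S hS u hu
  have hE := obsEnergy_nonneg G S hT.le u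
  have h3 := mul_le_mul_of_nonneg_left hint hC.le
  have h4 := mul_le_mul_of_nonneg_left ((hF₁ u).trans (add_le_add_left h1 _)) hC.le
  have h5 : (C * κ * T + C) * η * ‖u‖ ^ 2 = 1 / 2 * ‖u‖ ^ 2 := by
    rw [hη]
    field_simp
  have h6 : 0 ≤ C * κ * T * ‖γ‖ ^ 2 * obsEnergy G S T u := by positivity
  have h7 : 0 ≤ C * σ := by positivity
  have h8 : 0 ≤ C * obsEnergy G S T u := by positivity
  linarith

end PhaseFlow

section TorusBasis

/-- The normalised exponential `e^{ikx}/√(2π)` as an element of `L²(𝕋)`. -/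
def torusMode (k : ℤ) : L2T :=
  ((√(2 * π))⁻¹ : ℂ) • ContinuousMap.toLp 2 (volume : Measure Torus) ℂ (fourier k)

lemma sqrt_two_pi_mul_self : ((√(2 * π) : ℝ) : ℂ) * (√(2 * π) : ℝ) = 2 * π := by
  rw [← Complex.ofReal_mul, Real.mul_self_sqrt (by positivity)]
  push_cast
  rfl

lemma sqrt_two_pi_ne_zero : ((√(2 * π) : ℝ) : ℂ) ≠ 0 := by
  rw [Complex.ofReal_ne_zero]
  positivity

lemma orthonormal_torusMode : Orthonormal ℂ torusMode := by
  have hF := orthonormal_iff_ite.1 (orthonormal_fourier (T := 2 * π))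
  rw [orthonormal_iff_ite]
  intro i j
  have h1 : inner ℂ (ContinuousMap.toLp 2 (volume : Measure Torus) ℂ (fourier i))
      (ContinuousMap.toLp 2 (volume : Measure Torus) ℂ (fourier j)) =
      (2 * π : ℂ) * inner ℂ (fourierLp (T := 2 * π) 2 i) (fourierLp (T := 2 * π) 2 j) := by
    rw [ContinuousMap.inner_toLp, fourierLp, fourierLp, ContinuousMap.inner_toLp,
      AddCircle.integral_haarAddCircle, Complex.real_smul, ← mul_assoc]
    push_cast
    rw [mul_inv_cancel₀ (by exact_mod_cast two_pi_pos.ne'), one_mul]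
  rw [torusMode, torusMode, inner_smul_left, inner_smul_right, h1, hF, map_inv₀,
    Complex.conj_ofReal, ← sqrt_two_pi_mul_self]
  have := sqrt_two_pi_ne_zero
  split_ifs
  · field_simp
  · simp

lemma span_torusMode_closure_eq_top :
    (Submodule.span ℂ (Set.range torusMode)).topologicalClosure = ⊤ := by
  have h := (ContinuousMap.toLp_denseRange ℂ (volume : Measure Torus) ℂ
    (p := 2) (by simp)).topologicalClosure_map_submodule span_fourier_closure_eq_top
  rw [Submodule.map_span, ← Set.range_comp] at h
  rw [← h]
  congr 1
  refine le_antisymm (Submodule.span_le.2 ?_) (Submodule.span_le.2 ?_)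
  · rintro _ ⟨k, rfl⟩
    exact Submodule.smul_mem _ _ (Submodule.subset_span ⟨k, rfl⟩)
  · rintro _ ⟨k, rfl⟩
    have : (((√(2 * π) : ℝ) : ℂ)) • torusMode k ∈ Submodule.span ℂ (Set.range torusMode) :=
      Submodule.smul_mem _ _ (Submodule.subset_span ⟨k, rfl⟩)
    rwa [torusMode, smul_smul, mul_inv_cancel₀ sqrt_two_pi_ne_zero, one_smul] at this

/-- The Hilbert basis of normalised exponentials of `L²(𝕋)`. -/
def torusBasis : HilbertBasis ℤ ℂ L2T :=
  HilbertBasis.mk orthonormal_torusMode span_torusMode_closure_eq_top.ge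

lemma torusBasis_apply (k : ℤ) : torusBasis k = torusMode k := by
  rw [torusBasis, HilbertBasis.coe_mk]

lemma torusBasis_repr (u : L2T) (k : ℤ) :
    torusBasis.repr u k = (√(2 * π) : ℝ) * fc (u : Torus → ℂ) k := by
  have h1 : inner ℂ (ContinuousMap.toLp 2 (volume : Measure Torus) ℂ (fourier k)) u =
      ∫ x : Torus, fourier (-k) x * u x := by
    rw [L2.inner_def]
    refine integral_congr_ae ?_
    filter_upwards [ContinuousMap.coeFn_toLp (p := 2) (𝕜 := ℂ) (volume : Measure Torus)
      (fourier k)] with x hx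
    rw [hx, RCLike.inner_apply', fourier_neg]
  rw [torusBasis.repr_apply_apply, torusBasis_apply, torusMode, inner_smul_left, h1, fc, map_inv₀,
    Complex.conj_ofReal, ← sqrt_two_pi_mul_self]
  have := sqrt_two_pi_ne_zero
  field_simp

lemma meanZero_iff (u : L2T) : MeanZero u ↔ torusBasis.repr u 0 = 0 := by
  rw [torusBasis_repr, MeanZero, mul_eq_zero, or_iff_right sqrt_two_pi_ne_zero]

lemma isLamGroup_iff (lam : ℝ) (S : ℝ → L2T →L[ℂ] L2T) :
    IsLamGroup lam S ↔ IsPhaseFlow torusBasis (lamPhase lam) S := by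
  refine forall₂_congr fun t u => ?_
  rw [meanZero_iff]
  refine imp_congr_right fun hu => ?_
  rw [meanZero_iff]
  have key : ∀ k : ℤ, fc (S t u : Torus → ℂ) k =
      Complex.exp (Complex.I * (t : ℂ) * ((k : ℂ) ^ 3 - (lam : ℂ) ^ 2 / (k : ℂ))) *
        fc (u : Torus → ℂ) k ↔
      torusBasis.repr (S t u) k =
        Complex.exp (Complex.I * t * lamPhase lam k) * torusBasis.repr u k := by
    intro k
    rw [torusBasis_repr, torusBasis_repr, lamPhase, mul_left_comm,
      mul_right_inj' sqrt_two_pi_ne_zero]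
    push_cast
    rfl
  simp only [key]
  constructor
  · rintro ⟨h0, h⟩ k
    rcases eq_or_ne k 0 with rfl | hk
    · rw [h0, hu, mul_zero]
    · exact h k hk
  · intro h
    exact ⟨by rw [h, hu, mul_zero], fun k _ => h k⟩

lemma hneg1Sq_le (u : L2T) :
    Hneg1Sq u ≤ ∑' k : ℤ, (1 + (k : ℝ) ^ 2)⁻¹ * ‖torusBasis.repr u k‖ ^ 2 := by
  have hs : Summable fun k : ℤ => (1 + (k : ℝ) ^ 2)⁻¹ * ‖torusBasis.repr u k‖ ^ 2 := by
    refine Summable.of_nonneg_of_le (fun k => by positivity) (fun k => ?_)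
      (torusBasis.hasSum_norm_sq_repr u).summable
    exact mul_le_of_le_one_left (by positivity)
      (inv_le_one_of_one_le₀ (by nlinarith [sq_nonneg (k : ℝ)]))
  have hle : ∀ k : ℤ, (1 + (k : ℝ) ^ 2)⁻¹ * ‖fc (u : Torus → ℂ) k‖ ^ 2 ≤
      (1 + (k : ℝ) ^ 2)⁻¹ * ‖torusBasis.repr u k‖ ^ 2 := by
    intro k
    rw [torusBasis_repr, norm_mul, mul_pow, Complex.norm_real, Real.norm_of_nonneg (by positivity),
      Real.sq_sqrt (by positivity)]
    gcongr
    exact le_mul_of_one_le_left (by positivity) (by linarith [Real.pi_gt_three])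
  exact (Summable.of_nonneg_of_le (fun k => by positivity) hle hs).tsum_le_tsum hle hs

end TorusBasis

section Localisation

lemma L2T.norm_sq_eq (w : L2T) : ‖w‖ ^ 2 = ∫ x : Torus, ‖w x‖ ^ 2 := by
  have h : ((‖w‖ ^ 2 : ℝ) : ℂ) = ((∫ x : Torus, ‖w x‖ ^ 2 : ℝ) : ℂ) := by
    rw [← integral_complex_ofReal]
    push_cast
    rw [← Complex.coe_algebraMap, ← inner_self_eq_norm_sq_to_K (𝕜 := ℂ), L2.inner_def]
    exact integral_congr_ae (Eventually.of_forall fun x => inner_self_eq_norm_sq_to_K (𝕜 := ℂ) _)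
  exact_mod_cast h

/-- A continuous real weight on the torus, as an element of `L²(𝕋)`. -/
def weightL2 (g : Torus → ℝ) (hg : Continuous g) : L2T :=
  ContinuousMap.toLp 2 (volume : Measure Torus) ℂ
    ⟨fun x => (g x : ℂ), Complex.continuous_ofReal.comp hg⟩

variable {g : Torus → ℝ} (hg : Continuous g)

lemma coeFn_weightL2 : ∀ᵐ x : Torus, weightL2 g hg x = g x :=
  ContinuousMap.coeFn_toLp (p := 2) (𝕜 := ℂ) (volume : Measure Torus) _

lemma inner_weightL2 (v : L2T) : inner ℂ (weightL2 g hg) v = ∫ x : Torus, (g x : ℂ) * v x := by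
  rw [L2.inner_def]
  refine integral_congr_ae ?_
  filter_upwards [coeFn_weightL2 hg] with x hx
  rw [hx, RCLike.inner_apply', Complex.conj_ofReal]

lemma IsG.gMulNormSq_le {G : L2T →L[ℂ] L2T} (hG : IsG g G) (v : L2T) :
    gMulNormSq g v ≤
      2 * ‖G v‖ ^ 2 + 2 * ‖weightL2 g hg‖ ^ 2 * ‖inner ℂ (weightL2 g hg) v‖ ^ 2 := by
  set c := inner ℂ (weightL2 g hg) v with hc
  have h1 : gMulNormSq g v = ‖G v + c • weightL2 g hg‖ ^ 2 := by
    rw [L2T.norm_sq_eq, gMulNormSq]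
    refine integral_congr_ae ?_
    filter_upwards [hG v, coeFn_weightL2 hg, Lp.coeFn_add (G v) (c • weightL2 g hg),
      Lp.coeFn_smul c (weightL2 g hg)] with x h1 h2 h3 h4
    rw [h3, Pi.add_apply, h4, Pi.smul_apply, h1, h2, hc, inner_weightL2, smul_eq_mul]
    congr 2
    ring
  rw [h1]
  calc _ ≤ (‖G v‖ + ‖c • weightL2 g hg‖) ^ 2 := by
        gcongr
        exact norm_add_le _ _
    _ ≤ 2 * (‖G v‖ ^ 2 + ‖c • weightL2 g hg‖ ^ 2) := add_sq_le
    _ = _ := by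
      rw [norm_smul]
      ring

lemma IsG.eq {G G' : L2T →L[ℂ] L2T} (hG : IsG g G) (hG' : IsG g G') : G = G' := by
  ext1 v
  refine Lp.ext ?_
  filter_upwards [hG v, hG' v] with x h1 h2
  rw [h1, h2]

lemma analyticOnNhd_fourier_coe (k : ℤ) :
    AnalyticOnNhd ℝ (fun x : ℝ => fourier k (x : Torus)) Set.univ := by
  intro x _
  simp only [fourier_coe_apply]
  have h1 : AnalyticAt ℝ (fun x : ℝ => 2 * π * Complex.I * k * (x : ℂ) / ((2 * π : ℝ) : ℂ)) x := by
    have := Complex.ofRealCLM.analyticAt x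
    simp only [div_eq_mul_inv]
    exact (analyticAt_const.mul this).mul analyticAt_const
  exact (analyticAt_cexp.restrictScalars (𝕜 := ℝ)).comp h1

include hg in
lemma IsG.eq_zero_of_finite_support {G : L2T →L[ℂ] L2T} (hG : IsG g G) {x₀ : ℝ}
    (hx₀ : g (x₀ : Torus) ≠ 0) (F : Finset ℤ) (u : L2T) (hu : torusBasis.repr u 0 = 0)
    (hF : ∀ k ∉ F, torusBasis.repr u k = 0) (hGu : G u = 0) : u = 0 := by
  set a : ℤ → ℂ := fun k => torusBasis.repr u k * ((√(2 * π) : ℝ) : ℂ)⁻¹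
  set P : C(Torus, ℂ) := ∑ k ∈ F, a k • fourier k with hP
  have huP : u = ContinuousMap.toLp 2 (volume : Measure Torus) ℂ P := by
    have h1 : u = ∑ k ∈ F, torusBasis.repr u k • torusBasis k := by
      refine torusBasis.ext_repr fun k => ?_
      rw [torusBasis.repr_sum_smul]
      split_ifs with hk
      · rfl
      · exact hF k hk
    rw [hP, map_sum]
    conv_lhs => rw [h1]
    refine Finset.sum_congr rfl fun k _ => ?_
    rw [torusBasis_apply, torusMode, smul_smul, map_smul]
  set c : ℂ := ∫ x : Torus, (g x : ℂ) * u x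
  have hae : (fun x : Torus => (g x : ℂ) * (P x - c)) =ᵐ[volume] fun _ => 0 := by
    have hcoe := ContinuousMap.coeFn_toLp (p := 2) (𝕜 := ℂ) (volume : Measure Torus) P
    rw [← huP] at hcoe
    have h0 := hG u
    rw [hGu] at h0
    filter_upwards [h0, hcoe, Lp.coeFn_zero ℂ 2 (volume : Measure Torus)] with x h1 h2 h3
    rw [← h2, ← h1, h3, Pi.zero_apply]
  have hcont : Continuous fun x : Torus => (g x : ℂ) * (P x - c) :=
    (Complex.continuous_ofReal.comp hg).mul (P.continuous.sub continuous_const)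
  have hzero := (hcont.ae_eq_iff_eq volume continuous_const).1 hae
  have hPan : AnalyticOnNhd ℝ (fun x : ℝ => P (x : Torus)) Set.univ := by
    have : (fun x : ℝ => P (x : Torus)) = ∑ k ∈ F, fun x : ℝ => a k • fourier k (x : Torus) := by
      ext x
      simp [hP, ContinuousMap.sum_apply]
    rw [this]
    exact Finset.analyticOnNhd_sum _ fun k _ =>
      analyticOnNhd_const.smul (analyticOnNhd_fourier_coe k)
  have hloc : (fun x : ℝ => P (x : Torus)) =ᶠ[nhds x₀] fun _ => c := by
    have hg' : Continuous fun x : ℝ => g (x : Torus) := hg.comp (AddCircle.continuous_mk' _)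
    filter_upwards [hg'.continuousAt.eventually_ne hx₀] with x hx
    have := congrFun hzero (x : Torus)
    exact sub_eq_zero.1 ((mul_eq_zero.1 this).resolve_left (Complex.ofReal_ne_zero.2 hx))
  have hPc := hPan.eq_of_eventuallyEq analyticOnNhd_const hloc
  have hPc' : P = c • fourier 0 := by
    ext x
    obtain ⟨y, rfl⟩ := QuotientAddGroup.mk_surjective x
    simpa using congrFun hPc y
  have hu0 : u = (c * (√(2 * π) : ℝ)) • torusBasis 0 := by
    rw [huP, hPc', torusBasis_apply, torusMode, smul_smul, mul_assoc,
      mul_inv_cancel₀ sqrt_two_pi_ne_zero, mul_one, map_smul]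
  have hz : c * (√(2 * π) : ℝ) = 0 := by
    rw [hu0, map_smul, torusBasis.repr_self] at hu
    simpa using hu
  rw [hu0, hz, zero_smul]

end Localisation

/-- Proposition 3.6, weak observability implies full observability: if the
weak observability inequality
`‖u₀‖²_{L²} ≤ C ∫₀ᵀ ‖g·S_λ(t)u₀‖²_{L²} dt + C ‖u₀‖²_{H⁻¹}`
holds uniformly in `λ ≥ 0`, then the full observability inequality
`‖u₀‖²_{L²} ≤ C' ∫₀ᵀ ‖𝒢(S_λ(t)u₀)‖²_{L²} dt` holds uniformly in `λ ≥ 0`. -/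
theorem weak_observability_implies_full_observability
    -- `g` is a fixed real-valued C² function on `𝕋` (2π-periodic on `ℝ`), nonnegative,
    -- with integral 1, vanishing outside `(a,b) ⊂ (-π,π)`:
    (g : ℝ → ℝ) (hg_reg : ContDiff ℝ 2 g) (hg_per : Function.Periodic g (2 * Real.pi))
    (hg_nonneg : ∀ x, 0 ≤ g x)
    (a b : ℝ) (ha : -Real.pi < a) (hab : a < b) (hb : b < Real.pi)
    (hg_supp : ∀ x ∈ Set.Ioc (-Real.pi) Real.pi, g x ≠ 0 → x ∈ Set.Ioo a b)
    (hg_int : ∫ x in (-Real.pi)..Real.pi, g x = 1)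
    (T : ℝ) (hT : 0 < T)
    (hweak : ∃ C : ℝ, 0 < C ∧
      ∀ lam : ℝ, 0 ≤ lam →
        ∀ S : ℝ → L2T →L[ℂ] L2T, IsLamGroup lam S →
          ∀ u₀ : L2T, MeanZero u₀ →
            ‖u₀‖ ^ 2 ≤ C * (∫ t in (0:ℝ)..T, gMulNormSq hg_per.lift (S t u₀))
              + C * Hneg1Sq u₀) :
    ∃ C' : ℝ, 0 < C' ∧
      ∀ lam : ℝ, 0 ≤ lam →
        ∀ S : ℝ → L2T →L[ℂ] L2T, IsLamGroup lam S →
          ∀ G : L2T →L[ℂ] L2T, IsG hg_per.lift G →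
            ∀ u₀ : L2T, MeanZero u₀ →
              ‖u₀‖ ^ 2 ≤ C' * ∫ t in (0:ℝ)..T, ‖G (S t u₀)‖ ^ 2 := by
  by_cases hex : ∃ G₀ : L2T →L[ℂ] L2T, IsG hg_per.lift G₀
  swap
  · exact ⟨1, one_pos, fun _ _ _ _ G hG => absurd ⟨G, hG⟩ hex⟩
  obtain ⟨G₀, hG₀⟩ := hex
  have hg : Continuous (hg_per.lift : Torus → ℝ) := continuous_coinduced_dom.2 hg_reg.continuous
  obtain ⟨x₀, hx₀⟩ : ∃ x, g x ≠ 0 := by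
    by_contra! h
    simp [h] at hg_int
  obtain ⟨C, hC, hweak⟩ := hweak
  obtain ⟨C₁, hC₁, F, hF⟩ := exists_obs_mod_finite_of_weak_obs torusBasis G₀
    (weightL2 hg_per.lift hg) (gMulNormSq hg_per.lift) (by positivity)
    (fun v => integral_nonneg fun x => by positivity) (hG₀.gMulNormSq_le hg) hT hC
    fun lam h0 S hS u hu => by
      refine (hweak lam h0 S ((isLamGroup_iff lam S).2 hS) u ((meanZero_iff u).2 hu)).trans ?_
      gcongr
      exact hneg1Sq_le u
  obtain ⟨C', hC', hobs⟩ := exists_obs_of_obs_mod_finite torusBasis G₀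
    (hG₀.eq_zero_of_finite_support hg (x₀ := x₀) hx₀) hT hC₁ F hF
  refine ⟨C', hC', fun lam h0 S hS G hG u hu => ?_⟩
  rw [hG.eq hG₀]
  exact hobs lam h0 S ((isLamGroup_iff lam S).1 hS) u ((meanZero_iff u).1 hu)
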